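/- Suppose n ≥ 3, α ∈ (2,n), λ > n/(α−2), and σ = g_α(λ) = 0. Then there does not exist a pointwise bound for nonnegative solutions of the Choquard–Pekar inequality problem as x → 0: for every continuous φ : (0,1) → (0,∞) with φ(t) → ∞ as t → 0⁺, there exists a nonnegative solution u with u(x) ≠ O(φ(|x|)) as x → 0. -/

import Mathlib

open MeasureTheory Metric Filter Set Asymptotics Topology

/-- `ℝⁿ` as a Euclidean space. -/
abbrev Euc (n : ℕ) : Type := EuclideanSpace ℝ (Fin n)

/-- The Laplacian `Δu(x) = ∑ i ∂²u/∂xᵢ²(x)`. -/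
noncomputable def lap {n : ℕ} (u : Euc n → ℝ) (x : Euc n) : ℝ :=
  ∑ i : Fin n, iteratedFDeriv ℝ 2 u x ![EuclideanSpace.single i 1, EuclideanSpace.single i 1]

/-- `u` is a nonnegative solution of the Choquard–Pekar inequality problem:
`u ∈ C²(ℝⁿ \ {0}) ∩ L^λ(ℝⁿ)` and
`0 ≤ -Δu(x) ≤ (∫ |x-y|^(-α) u(y)^λ dy) · u(x)^σ` on `B₂(0) \ {0}`. -/
def IsCPSolution (n : ℕ) (α lam sig : ℝ) (u : Euc n → ℝ) : Prop :=
  (∀ x, 0 ≤ u x) ∧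
  ContDiffOn ℝ 2 u {0}ᶜ ∧
  Integrable (fun y => u y ^ lam) ∧
  ∀ x ∈ ball (0 : Euc n) 2 \ {0},
    0 ≤ -lap u x ∧
    -lap u x ≤ (∫ y, ‖x - y‖ ^ (-α) * u y ^ lam) * u x ^ sig

/-- `u(x) ≠ O(φ(|x|))` as `x → 0`: there is a sequence `x_j → 0` with
`u(x_j)/φ(|x_j|) → ∞`. -/
def NotBigOAt (n : ℕ) (u : Euc n → ℝ) (φ : ℝ → ℝ) : Prop :=
  ∃ x : ℕ → Euc n, (∀ j, x j ≠ 0) ∧ Tendsto x atTop (𝓝 0) ∧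
    Tendsto (fun j => u (x j) / φ ‖x j‖) atTop atTop

section Bubble

variable {E : Type*} [NormedAddCommGroup E] [InnerProductSpace ℝ E]

/-- The real inner product as a continuous bilinear map, with plain linear type. -/
noncomputable def realInnerL (E : Type*) [NormedAddCommGroup E] [InnerProductSpace ℝ E] :
    E →L[ℝ] E →L[ℝ] ℝ := innerSL ℝ

lemma realInnerL_apply (y z : E) : realInnerL E y z = inner ℝ y z := rfl

lemma norm_realInnerL_apply (y : E) : ‖realInnerL E y‖ = ‖y‖ := innerSL_apply_norm ℝ y

lemma norm_realInnerL_le : ‖realInnerL E‖ ≤ 1 := norm_innerSL_le ℝ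

/-- The Aubin–Talenti type profile `(s + ‖y‖²)^(-m)`. -/
noncomputable def bubble (s m : ℝ) (y : E) : ℝ := (s + ‖y‖ ^ 2) ^ (-m)

/-- The first derivative of `bubble s m`. -/
noncomputable def bubbleD (s m : ℝ) (y : E) : E →L[ℝ] ℝ :=
  (-2 * m * (s + ‖y‖ ^ 2) ^ (-m - 1)) • realInnerL E y

/-- The second derivative of `bubble s m`. -/
noncomputable def bubbleDD (s m : ℝ) (y : E) : E →L[ℝ] E →L[ℝ] ℝ :=
  (-2 * m * (s + ‖y‖ ^ 2) ^ (-m - 1)) • realInnerL E +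
    ((4 * m * (m + 1) * (s + ‖y‖ ^ 2) ^ (-m - 2)) • realInnerL E y).smulRight (realInnerL E y)

lemma hasFDerivAt_const_add_norm_sq_rpow {s : ℝ} (hs : 0 < s) (p : ℝ) (y : E) :
    HasFDerivAt (fun y : E => (s + ‖y‖ ^ 2) ^ p)
      ((2 * p * (s + ‖y‖ ^ 2) ^ (p - 1)) • realInnerL E y) y := by
  have h := ((hasStrictFDerivAt_norm_sq y).hasFDerivAt.const_add s).rpow_const (p := p)
    (Or.inl (by positivity))
  refine h.congr_fderiv ?_
  ext z
  simp [realInnerL_apply]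
  ring

lemma hasFDerivAt_bubble {s : ℝ} (hs : 0 < s) (m : ℝ) (y : E) :
    HasFDerivAt (bubble s m) (bubbleD s m y) y := by
  have h := hasFDerivAt_const_add_norm_sq_rpow hs (-m) y
  rw [show 2 * -m = -2 * m by ring] at h
  exact h

lemma hasFDerivAt_bubbleD {s : ℝ} (hs : 0 < s) (m : ℝ) (y : E) :
    HasFDerivAt (bubbleD s m) (bubbleDD s m y) y := by
  have h := ((hasFDerivAt_const_add_norm_sq_rpow hs (-m - 1) y).const_mul (-2 * m)).smul
    ((realInnerL E).hasFDerivAt (x := y))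
  refine h.congr_fderiv ?_
  ext z w
  simp only [bubbleDD]
  rw [show -m - 1 - 1 = -m - 2 by ring]
  simp [realInnerL_apply]
  ring

lemma continuous_bubbleDD {s : ℝ} (hs : 0 < s) (m : ℝ) :
    Continuous (bubbleDD s m : E → E →L[ℝ] E →L[ℝ] ℝ) := by
  have h : ∀ p : ℝ, Continuous (fun y : E => (s + ‖y‖ ^ 2) ^ p) := fun p =>
    (continuous_const.add (continuous_norm.pow 2)).rpow_const
      (fun y => Or.inl (add_pos_of_pos_of_nonneg hs (sq_nonneg _)).ne')
  have hi : Continuous (fun y : E => realInnerL E y) := (realInnerL E).continuous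
  unfold bubbleDD
  have hR : Continuous fun y : E => ContinuousLinearMap.smulRightL ℝ E (E →L[ℝ] ℝ)
      ((4 * m * (m + 1) * (s + ‖y‖ ^ 2) ^ (-m - 2)) • realInnerL E y) :=
    (ContinuousLinearMap.smulRightL ℝ E (E →L[ℝ] ℝ)).continuous.comp
      (Continuous.smul (continuous_const.mul (h (-m - 2))) hi)
  exact (Continuous.smul (continuous_const.mul (h _)) continuous_const).add (hR.clm_apply hi)

lemma norm_bubbleD_le {s m δ R : ℝ} (hs : 0 < s) (hm : 0 ≤ m) (hδ : 0 < δ) {y : E}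
    (hy : δ ≤ s + ‖y‖ ^ 2) (hR : ‖y‖ ≤ R) :
    ‖bubbleD s m y‖ ≤ 2 * m * δ ^ (-m - 1) * R := by
  have h1 : (s + ‖y‖ ^ 2) ^ (-m - 1) ≤ δ ^ (-m - 1) :=
    Real.rpow_le_rpow_of_nonpos hδ hy (by linarith)
  have h0 : 0 ≤ (s + ‖y‖ ^ 2) ^ (-m - 1) := by positivity
  rw [bubbleD, norm_smul, norm_realInnerL_apply, Real.norm_eq_abs, neg_mul, neg_mul, abs_neg,
    abs_of_nonneg (by positivity)]
  gcongr

lemma norm_smul_continuousLinearMap {F : Type*} [NormedAddCommGroup F] [NormedSpace ℝ F]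
    (c : ℝ) (L : E →L[ℝ] F) : ‖c • L‖ = |c| * ‖L‖ := norm_smul c L

lemma norm_bubbleDD_le {s m δ R : ℝ} (hs : 0 < s) (hm : 0 ≤ m) (hδ : 0 < δ) {y : E}
    (hy : δ ≤ s + ‖y‖ ^ 2) (hR : ‖y‖ ≤ R) :
    ‖bubbleDD s m y‖ ≤ 2 * m * δ ^ (-m - 1) + 4 * m * (m + 1) * δ ^ (-m - 2) * R ^ 2 := by
  have h1 : (s + ‖y‖ ^ 2) ^ (-m - 1) ≤ δ ^ (-m - 1) :=
    Real.rpow_le_rpow_of_nonpos hδ hy (by linarith)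
  have h2 : (s + ‖y‖ ^ 2) ^ (-m - 2) ≤ δ ^ (-m - 2) :=
    Real.rpow_le_rpow_of_nonpos hδ hy (by linarith)
  have h0 : 0 ≤ (s + ‖y‖ ^ 2) ^ (-m - 1) := by positivity
  have h0' : 0 ≤ (s + ‖y‖ ^ 2) ^ (-m - 2) := by positivity
  have hI : ‖realInnerL E‖ ≤ 1 := norm_realInnerL_le
  unfold bubbleDD
  refine norm_add_le_of_le (E := E →L[ℝ] E →L[ℝ] ℝ) ?_ ?_
  · rw [norm_smul_continuousLinearMap, neg_mul, neg_mul, abs_neg, abs_of_nonneg (by positivity)]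
    calc _ ≤ 2 * m * δ ^ (-m - 1) * 1 := by gcongr
      _ = _ := mul_one _
  · rw [ContinuousLinearMap.norm_smulRight_apply, norm_smul, norm_realInnerL_apply,
      Real.norm_eq_abs, abs_of_nonneg (by positivity), mul_assoc, ← sq]
    gcongr

end Bubble

lemma bubble_le {E : Type*} [NormedAddCommGroup E] {s m δ : ℝ} (hs : 0 < s)
    (hm : 0 ≤ m) (hδ : 0 < δ) {y : E} (hy : δ ≤ s + ‖y‖ ^ 2) : |bubble s m y| ≤ δ ^ (-m) := by
  have : 0 ≤ bubble s m y := by unfold bubble; positivity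
  rw [abs_of_nonneg this]
  exact Real.rpow_le_rpow_of_nonpos hδ hy (by linarith)

lemma contDiffOn_two_of_hasFDerivAt {E : Type*} [NormedAddCommGroup E] [NormedSpace ℝ E]
    {f : E → ℝ} {f' : E → E →L[ℝ] ℝ} {f'' : E → E →L[ℝ] E →L[ℝ] ℝ} {U : Set E} (hU : IsOpen U)
    (h1 : ∀ x ∈ U, HasFDerivAt f (f' x) x) (h2 : ∀ x ∈ U, HasFDerivAt f' (f'' x) x)
    (h3 : ContinuousOn f'' U) : ContDiffOn ℝ 2 f U := by
  have c1 : ContDiffOn ℝ 1 f' U := by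
    refine (contDiffOn_succ_iff_fderiv_of_isOpen (n := 0) hU).2
      ⟨fun x hx => (h2 x hx).differentiableAt.differentiableWithinAt, by simp, ?_⟩
    exact contDiffOn_zero.2 (h3.congr fun x hx => (h2 x hx).fderiv)
  refine (contDiffOn_succ_iff_fderiv_of_isOpen (n := 1) hU).2
    ⟨fun x hx => (h1 x hx).differentiableAt.differentiableWithinAt, by simp, ?_⟩
  exact c1.congr fun x hx => (h1 x hx).fderiv

set_option maxHeartbeats 2000000 in
/-- A series of `C²` functions converging uniformly with its derivatives up to order two. -/
lemma contDiffOn_two_tsum_of_isPreconnected {E : Type*} [NormedAddCommGroup E] [NormedSpace ℝ E]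
    {f : ℕ → E → ℝ} {f' : ℕ → E → E →L[ℝ] ℝ} {f'' : ℕ → E → E →L[ℝ] E →L[ℝ] ℝ} {b : ℕ → ℝ}
    (hb : Summable b) {U : Set E} (hU : IsOpen U) (hUc : IsPreconnected U)
    (h1 : ∀ j, ∀ x ∈ U, HasFDerivAt (f j) (f' j x) x)
    (h2 : ∀ j, ∀ x ∈ U, HasFDerivAt (f' j) (f'' j x) x)
    (h3 : ∀ j, ContinuousOn (f'' j) U)
    (b0 : ∀ j, ∀ x ∈ U, |f j x| ≤ b j) (b1 : ∀ j, ∀ x ∈ U, ‖f' j x‖ ≤ b j)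
    (b2 : ∀ j, ∀ x ∈ U, ‖f'' j x‖ ≤ b j) :
    ContDiffOn ℝ 2 (fun x => ∑' j, f j x) U ∧
      ∀ x ∈ U, HasSum (fun j => f'' j x) (fderiv ℝ (fderiv ℝ (fun x => ∑' j, f j x)) x) := by
  have s0 : ∀ x ∈ U, Summable fun j => f j x := fun x hx =>
    Summable.of_norm_bounded (E := ℝ) hb (fun j => b0 j x hx)
  have s1 : ∀ x ∈ U, Summable fun j => f' j x := fun x hx =>
    Summable.of_norm_bounded (E := E →L[ℝ] ℝ) hb (fun j => b1 j x hx)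
  have s2 : ∀ x ∈ U, Summable fun j => f'' j x := fun x hx =>
    Summable.of_norm_bounded (E := E →L[ℝ] E →L[ℝ] ℝ) hb (fun j => b2 j x hx)
  have d1 : ∀ x ∈ U, HasFDerivAt (fun x => ∑' j, f j x) (∑' j, f' j x) x := fun x hx =>
    hasFDerivAt_tsum_of_isPreconnected hb hU hUc h1 b1 hx (s0 x hx) hx
  have d2 : ∀ x ∈ U, HasFDerivAt (fun x => ∑' j, f' j x) (∑' j, f'' j x) x := fun x hx =>
    hasFDerivAt_tsum_of_isPreconnected (f := f') (f' := f'') hb hU hUc h2 b2 hx (s1 x hx) hx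
  have d2' : ∀ x ∈ U, HasFDerivAt (fderiv ℝ (fun x => ∑' j, f j x)) (∑' j, f'' j x) x := by
    intro x hx
    refine (d2 x hx).congr_of_eventuallyEq ?_
    filter_upwards [hU.mem_nhds hx] with y hy using (d1 y hy).fderiv
  have c2 : ContinuousOn (fun x => ∑' j, f'' j x) U :=
    continuousOn_tsum (F := E →L[ℝ] E →L[ℝ] ℝ) h3 hb (fun j x hx => b2 j x hx)
  constructor
  · exact contDiffOn_two_of_hasFDerivAt hU d1 d2 c2
  · intro x hx
    rw [(d2' x hx).fderiv]
    exact (s2 x hx).hasSum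

lemma sum_bubbleDD_apply {n : ℕ} {s : ℝ} (hs : 0 < s) (y : Euc n) :
    ∑ i : Fin n, bubbleDD s (((n : ℝ) - 2) / 2) y (EuclideanSpace.single i 1)
        (EuclideanSpace.single i 1) =
      -((n : ℝ) * (n - 2) * s * (s + ‖y‖ ^ 2) ^ (-((n : ℝ) + 2) / 2)) := by
  have hq : 0 < s + ‖y‖ ^ 2 := by positivity
  have hy : ∑ i : Fin n, y i * y i = ‖y‖ ^ 2 := by
    rw [EuclideanSpace.real_norm_sq_eq]
    simp [sq]
  have e1 : (s + ‖y‖ ^ 2) ^ (-(((n : ℝ) - 2) / 2) - 1) =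
      (s + ‖y‖ ^ 2) ^ (-((n : ℝ) + 2) / 2) * (s + ‖y‖ ^ 2) := by
    rw [← Real.rpow_add_one hq.ne']
    congr 1
    ring
  have e2 : -(((n : ℝ) - 2) / 2) - 2 = -((n : ℝ) + 2) / 2 := by ring
  simp only [bubbleDD, e1, e2]
  simp [realInnerL_apply, Finset.sum_add_distrib, EuclideanSpace.inner_single_right, mul_assoc,
    ← Finset.mul_sum, hy]
  ring

lemma exists_pos_le_of_eventually {ι : Type*} {t : ℕ → ι → ℝ} {s : ℕ → ℝ} {ε : ℝ} (hε : 0 < ε)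
    (hs : ∀ j, 0 < s j) (hst : ∀ j i, s j ≤ t j i) (ht : ∀ᶠ j in atTop, ∀ i, ε ≤ t j i) :
    ∃ δ > 0, ∀ j i, δ ≤ t j i := by
  obtain ⟨N, hN⟩ := eventually_atTop.1 ht
  have key : ∀ N : ℕ, ∃ δ > 0, ∀ j < N, δ ≤ s j := by
    intro N
    induction N with
    | zero => exact ⟨1, one_pos, by simp⟩
    | succ k ih =>
      obtain ⟨δ, hδ, h⟩ := ih
      refine ⟨min δ (s k), lt_min hδ (hs k), fun j hj => ?_⟩
      rcases Nat.lt_succ_iff_lt_or_eq.1 hj with h' | rfl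
      · exact (min_le_left _ _).trans (h j h')
      · exact min_le_right _ _
  obtain ⟨δ, hδ, h⟩ := key N
  refine ⟨min δ ε, lt_min hδ hε, fun j i => ?_⟩
  rcases lt_or_ge j N with hj | hj
  · exact (min_le_left _ _).trans ((h j hj).trans (hst j i))
  · exact (min_le_right _ _).trans (hN j hj i)

lemma exists_bubble_bounds {n : ℕ} {m : ℝ} (hm : 0 ≤ m) {a : ℕ → Euc n} {s : ℕ → ℝ}
    (hs : ∀ j, 0 < s j) (ha : Tendsto a atTop (𝓝 0)) {x₀ : Euc n} (hx₀ : x₀ ≠ 0) :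
    ∃ K : ℝ, ∀ j, ∀ x ∈ ball x₀ (‖x₀‖ / 2), |bubble (s j) m (x - a j)| ≤ K ∧
      ‖bubbleD (s j) m (x - a j)‖ ≤ K ∧ ‖bubbleDD (s j) m (x - a j)‖ ≤ K := by
  have hx₀' : 0 < ‖x₀‖ := norm_pos_iff.2 hx₀
  obtain ⟨A, hA⟩ := ha.norm.bddAbove_range
  have hA' : ∀ j, ‖a j‖ ≤ A := fun j => hA ⟨j, rfl⟩
  have hA0 : 0 ≤ A := (norm_nonneg _).trans (hA' 0)
  have hev : ∀ᶠ j in atTop, ‖a j‖ ≤ ‖x₀‖ / 4 := by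
    have h0 : Tendsto (fun j => ‖a j‖) atTop (𝓝 0) := by simpa using ha.norm
    exact (h0.eventually_lt_const (by positivity)).mono fun _ h => h.le
  obtain ⟨δ, hδ, h⟩ := exists_pos_le_of_eventually (ι := ball x₀ (‖x₀‖ / 2))
    (t := fun j x => s j + ‖(x : Euc n) - a j‖ ^ 2) (s := s) (ε := (‖x₀‖ / 4) ^ 2)
    (by positivity) hs (fun j i => le_add_of_nonneg_right (sq_nonneg _)) (by
      filter_upwards [hev] with j hj x
      have hx : ‖(x : Euc n) - x₀‖ < ‖x₀‖ / 2 := by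
        rw [← dist_eq_norm]; exact x.2
      have h1 : ‖x₀‖ ≤ ‖(x : Euc n) - a j‖ + ‖a j‖ + ‖(x : Euc n) - x₀‖ := by
        calc ‖x₀‖ = ‖((x : Euc n) - a j) + a j - ((x : Euc n) - x₀)‖ := by congr 1; abel
          _ ≤ _ := (norm_sub_le _ _).trans (add_le_add_left (norm_add_le _ _) _)
      have h2 : ‖x₀‖ / 4 ≤ ‖(x : Euc n) - a j‖ := by linarith
      have := pow_le_pow_left₀ (by positivity) h2 2
      linarith [hs j])
  set R := 2 * ‖x₀‖ + A
  have hR : 0 ≤ R := by positivity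
  have p0 : 0 ≤ δ ^ (-m) := by positivity
  have p1 : 0 ≤ 2 * m * δ ^ (-m - 1) * R := by positivity
  have p2 : 0 ≤ 2 * m * δ ^ (-m - 1) + 4 * m * (m + 1) * δ ^ (-m - 2) * R ^ 2 := by positivity
  refine ⟨δ ^ (-m) + 2 * m * δ ^ (-m - 1) * R +
    (2 * m * δ ^ (-m - 1) + 4 * m * (m + 1) * δ ^ (-m - 2) * R ^ 2), fun j x hx => ?_⟩
  have hq := h j ⟨x, hx⟩
  have hxR : ‖x - a j‖ ≤ R := by
    have hx' : ‖x - x₀‖ < ‖x₀‖ / 2 := by simpa [dist_eq_norm] using hx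
    have h1 : ‖x - a j‖ ≤ ‖x - x₀‖ + ‖x₀‖ + ‖a j‖ := by
      calc ‖x - a j‖ = ‖(x - x₀) + x₀ - a j‖ := by congr 1; abel
        _ ≤ _ := (norm_sub_le _ _).trans (add_le_add_left (norm_add_le _ _) _)
    linarith [hA' j]
  refine ⟨(bubble_le (hs j) hm hδ hq).trans (by linarith),
    (norm_bubbleD_le (hs j) hm hδ hq hxR).trans (by linarith),
    (norm_bubbleDD_le (hs j) hm hδ hq hxR).trans (by linarith)⟩

/-- Superpositions of bubbles whose centres tend to the origin are `C²` off the origin, and may be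
differentiated termwise. -/
lemma bubble_series {n : ℕ} (hn : 3 ≤ n) {a : ℕ → Euc n} {c s : ℕ → ℝ}
    (hc : ∀ j, 0 < c j) (hs : ∀ j, 0 < s j) (hcs : Summable c) (ha : Tendsto a atTop (𝓝 0))
    {u : Euc n → ℝ} (hu : u = fun x => ∑' j, c j * bubble (s j) (((n : ℝ) - 2) / 2) (x - a j)) :
    ContDiffOn ℝ 2 u {0}ᶜ ∧ ∀ x ≠ 0,
      Summable (fun j => c j * bubble (s j) (((n : ℝ) - 2) / 2) (x - a j)) ∧
      HasSum (fun j => c j * ((n : ℝ) * (n - 2) * s j *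
        (s j + ‖x - a j‖ ^ 2) ^ (-((n : ℝ) + 2) / 2))) (-lap u x) := by
  have hn' : (3 : ℝ) ≤ n := by exact_mod_cast hn
  set m : ℝ := ((n : ℝ) - 2) / 2 with hm_def
  have hm : 0 ≤ m := by rw [hm_def]; linarith
  have main : ∀ x₀ : Euc n, x₀ ≠ 0 → ContDiffOn ℝ 2 u (ball x₀ (‖x₀‖ / 2)) ∧
      HasSum (fun j => c j • bubbleDD (s j) m (x₀ - a j)) (fderiv ℝ (fderiv ℝ u) x₀) ∧
      Summable (fun j => c j * bubble (s j) m (x₀ - a j)) := by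
    intro x₀ hx₀
    obtain ⟨K, hK⟩ := exists_bubble_bounds hm hs ha hx₀
    have hx₀m : x₀ ∈ ball x₀ (‖x₀‖ / 2) := mem_ball_self (by positivity)
    have hb : Summable fun j => c j * K := hcs.mul_right K
    have hsub : ∀ j x, HasFDerivAt (fun x : Euc n => x - a j) (ContinuousLinearMap.id ℝ (Euc n)) x :=
      fun j x => (hasFDerivAt_id x).sub_const _
    have B0 : ∀ j, ∀ x ∈ ball x₀ (‖x₀‖ / 2), |c j * bubble (s j) m (x - a j)| ≤ c j * K := by
      intro j x hx
      rw [abs_mul, abs_of_pos (hc j)]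
      exact mul_le_mul_of_nonneg_left (hK j x hx).1 (hc j).le
    have := contDiffOn_two_tsum_of_isPreconnected
      (f := fun j x => c j * bubble (s j) m (x - a j))
      (f' := fun j x => c j • bubbleD (s j) m (x - a j))
      (f'' := fun j x => c j • bubbleDD (s j) m (x - a j)) hb isOpen_ball
      (convex_ball x₀ (‖x₀‖ / 2)).isPreconnected
      (fun j x _ => ((hasFDerivAt_bubble (hs j) m (x - a j)).comp x (hsub j x)).const_mul (c j))
      (fun j x _ => ((hasFDerivAt_bubbleD (hs j) m (x - a j)).comp x (hsub j x)).const_smul (c j))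
      (fun j => ((((continuous_bubbleDD (hs j) m).comp
        (continuous_id.sub continuous_const)).const_smul (c j)).continuousOn))
      B0
      (fun j x hx => by
        rw [norm_smul, Real.norm_of_nonneg (hc j).le]
        exact mul_le_mul_of_nonneg_left (hK j x hx).2.1 (hc j).le)
      (fun j x hx => by
        rw [norm_smul_continuousLinearMap, abs_of_pos (hc j)]
        exact mul_le_mul_of_nonneg_left (hK j x hx).2.2 (hc j).le)
    rw [hu]
    exact ⟨this.1, this.2 x₀ hx₀m, hb.of_norm_bounded (fun j => B0 j x₀ hx₀m)⟩
  refine ⟨fun x hx => ?_, fun x hx => ⟨(main x hx).2.2, ?_⟩⟩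
  · exact ((main x hx).1.contDiffAt (ball_mem_nhds x
      (half_pos (norm_pos_iff.2 hx)))).contDiffWithinAt
  · have h := (main x hx).2.1
    have h2 : ∀ e : Euc n, HasSum (fun j => c j * bubbleDD (s j) m (x - a j) e e)
        (fderiv ℝ (fderiv ℝ u) x e e) := by
      intro e
      have := (h.mapL (ContinuousLinearMap.apply ℝ (Euc n →L[ℝ] ℝ) e)).mapL
        (ContinuousLinearMap.apply ℝ ℝ e)
      simpa using this
    have h3 := (hasSum_sum (s := Finset.univ) fun (i : Fin n) _ =>
      h2 (EuclideanSpace.single i 1)).neg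
    have hlap : -lap u x = -∑ i : Fin n, fderiv ℝ (fderiv ℝ u) x (EuclideanSpace.single i 1)
        (EuclideanSpace.single i 1) := by
      simp [lap, iteratedFDeriv_two_apply]
    rw [hlap]
    refine h3.congr_fun fun j => ?_
    rw [← Finset.mul_sum, sum_bubbleDD_apply (hs j)]
    ring

lemma scaled_bubble_eq {E : Type*} [NormedAddCommGroup E] [InnerProductSpace ℝ E] {r : ℝ}
    (hr : 0 < r) (H m : ℝ) (y : E) :
    H * r ^ (2 * m) * bubble (r ^ 2) m y = H * (1 + ‖r⁻¹ • y‖ ^ 2) ^ (-m) := by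
  have h : r ^ 2 + ‖y‖ ^ 2 = r ^ 2 * (1 + ‖r⁻¹ • y‖ ^ 2) := by
    rw [norm_smul, norm_inv, Real.norm_of_nonneg hr.le]
    field_simp
  have h2 : (r ^ 2) ^ (-m) = r ^ (-(2 * m)) := by
    rw [← Real.rpow_natCast_mul hr.le]
    congr 1
    push_cast
    ring
  rw [bubble, h, Real.mul_rpow (by positivity) (by positivity), h2, Real.rpow_neg hr.le]
  field_simp

lemma eLpNorm_scaled_bubble_le {n : ℕ} {m lam : ℝ} (hlam : 0 < lam) (hm : n < 2 * m * lam) :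
    ∃ I : ℝ, 0 ≤ I ∧ ∀ (r H : ℝ) (a : Euc n), 0 < r → 0 < H →
      eLpNorm (fun y => H * r ^ (2 * m) * bubble (r ^ 2) m (y - a)) (ENNReal.ofReal lam) volume ≤
        ENNReal.ofReal (H * r ^ ((n : ℝ) / lam) * I) := by
  set g : Euc n → ℝ := fun z => ((1 + ‖z‖ ^ 2) ^ (-m)) ^ lam with hg
  have hgi : Integrable g := by
    have h := integrable_rpow_neg_one_add_norm_sq (E := Euc n) (μ := volume) (r := 2 * m * lam)
      (by simpa using hm)
    refine h.congr (Eventually.of_forall fun z => ?_)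
    simp only [hg]
    rw [← Real.rpow_mul (by positivity)]
    congr 1
    ring
  have hg0 : ∀ z, 0 ≤ g z := fun z => by simp only [hg]; positivity
  refine ⟨(∫ z, g z) ^ (1 / lam), by positivity, fun r H a hr hH => ?_⟩
  have hfun : ∀ y, |H * r ^ (2 * m) * bubble (r ^ 2) m (y - a)| ^ lam =
      H ^ lam * g (r⁻¹ • (y - a)) := by
    intro y
    rw [scaled_bubble_eq hr, abs_of_nonneg (by positivity),
      Real.mul_rpow hH.le (by positivity)]
  have hint : ∫ y, |H * r ^ (2 * m) * bubble (r ^ 2) m (y - a)| ^ lam =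
      H ^ lam * (r ^ n * ∫ z, g z) := by
    simp_rw [hfun]
    rw [integral_const_mul, integral_sub_right_eq_self (fun y => g (r⁻¹ • y)) a,
      Measure.integral_comp_inv_smul_of_nonneg volume g hr.le]
    simp
  have hii : Integrable fun y => |H * r ^ (2 * m) * bubble (r ^ 2) m (y - a)| ^ lam := by
    simp_rw [hfun]
    exact ((hgi.comp_smul (inv_ne_zero hr.ne')).comp_sub_right a).const_mul _
  have hmeas : AEStronglyMeasurable
      (fun y => H * r ^ (2 * m) * bubble (r ^ 2) m (y - a)) volume := by
    refine Continuous.aestronglyMeasurable ?_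
    unfold bubble
    refine continuous_const.mul (Continuous.rpow_const (by fun_prop) fun y => Or.inl ?_)
    positivity
  have hp0 : ENNReal.ofReal lam ≠ 0 := by simpa using hlam
  have hmem : MemLp (fun y => H * r ^ (2 * m) * bubble (r ^ 2) m (y - a))
      (ENNReal.ofReal lam) volume := by
    rw [← integrable_norm_rpow_iff hmeas hp0 ENNReal.ofReal_ne_top]
    simpa [ENNReal.toReal_ofReal hlam.le] using hii
  rw [hmem.eLpNorm_eq_integral_rpow_norm hp0 ENNReal.ofReal_ne_top,
    ENNReal.toReal_ofReal hlam.le]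
  simp_rw [Real.norm_eq_abs]
  rw [hint]
  apply le_of_eq
  congr 1
  have hI : 0 ≤ ∫ z, g z := integral_nonneg hg0
  rw [Real.mul_rpow (by positivity) (by positivity), Real.mul_rpow (by positivity) hI,
    ← Real.rpow_mul hH.le, ← Real.rpow_natCast_mul hr.le, mul_inv_cancel₀ hlam.ne', Real.rpow_one,
    div_eq_mul_inv, one_div, mul_assoc]

lemma exists_scale {d α lam : ℝ} (hd : α < d) (hα : 2 < α) (hlam : d / (α - 2) < lam)
    (C P : ℝ) {ε : ℝ} (hε : 0 < ε) :
    ∃ r H : ℝ, 0 < r ∧ r ≤ 1 ∧ 0 < H ∧ H * r ^ (d / lam) ≤ ε ∧ P ≤ H ∧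
      C ≤ H ^ (lam - 1) * r ^ (d + 2 - α) := by
  have hd1 : 1 < d / (α - 2) := by rw [lt_div_iff₀ (by linarith)]; linarith
  have hl : 1 < lam := hd1.trans hlam
  have hl' : d < lam * (α - 2) := (div_lt_iff₀ (by linarith)).1 hlam
  have hgap : (d + 2 - α) / (lam - 1) < d / lam := by
    rw [div_lt_div_iff₀ (by linarith) (by linarith)]
    nlinarith
  obtain ⟨θ, h1, h2⟩ := exists_between hgap
  have hθ : 0 < θ := lt_trans (div_pos (by linarith) (by linarith)) h1
  have h1' : d + 2 - α < θ * (lam - 1) := (div_lt_iff₀ (by linarith)).1 h1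
  have top : ∀ p : ℝ, p < 0 → Tendsto (fun r : ℝ => r ^ p) (𝓝[>] 0) atTop := fun p hp =>
    tendsto_rpow_neg_nhdsGT_zero hp
  have zero : Tendsto (fun r : ℝ => r ^ (d / lam - θ)) (𝓝[>] 0) (𝓝 0) := by
    have := ((Real.continuousAt_rpow_const 0 (d / lam - θ) (Or.inr (by linarith))).tendsto).mono_left
      (nhdsWithin_le_nhds (s := Ioi (0 : ℝ)))
    rwa [Real.zero_rpow (by linarith)] at this
  have ev := (zero.eventually_le_const hε).and (((top (-θ) (by linarith)).eventually_ge_atTop P).and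
    (((top (-θ * (lam - 1) + (d + 2 - α)) (by linarith)).eventually_ge_atTop C).and
      (Ioo_mem_nhdsGT (one_pos (α := ℝ)))))
  obtain ⟨r, e1, e2, e3, hr0, hr1⟩ := ev.exists
  refine ⟨r, r ^ (-θ), hr0, hr1.le, by positivity, ?_, e2, ?_⟩
  · rw [← Real.rpow_add hr0]
    rwa [show -θ + d / lam = d / lam - θ by ring]
  · rw [← Real.rpow_mul hr0.le, ← Real.rpow_add hr0]
    exact e3

lemma memLp_tsum {Ω : Type*} [MeasurableSpace Ω] {μ : Measure Ω} {p : ENNReal}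
    (hp : 1 ≤ p) {f : ℕ → Ω → ℝ} {b : ℕ → ℝ} (hf : ∀ j, AEStronglyMeasurable (f j) μ)
    (hb : Summable b) (hb0 : ∀ j, 0 ≤ b j) (hfb : ∀ j, eLpNorm (f j) p μ ≤ ENNReal.ofReal (b j))
    (hs : ∀ᵐ x ∂μ, Summable fun j => f j x) : MemLp (fun x => ∑' j, f j x) p μ := by
  have hlim : ∀ᵐ x ∂μ, Tendsto (fun N => (∑ j ∈ Finset.range N, f j) x) atTop
      (𝓝 (∑' j, f j x)) := by
    filter_upwards [hs] with x hx
    simpa using hx.hasSum.tendsto_sum_nat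
  have hm : ∀ N, AEStronglyMeasurable (∑ j ∈ Finset.range N, f j) μ := fun N =>
    Finset.aestronglyMeasurable_sum _ fun j _ => hf j
  refine ⟨aestronglyMeasurable_of_tendsto_ae atTop hm hlim, ?_⟩
  refine (Lp.eLpNorm_lim_le_liminf_eLpNorm hm _ hlim).trans_lt ?_
  have hN : ∀ N, eLpNorm (∑ j ∈ Finset.range N, f j) p μ ≤ ENNReal.ofReal (∑' j, b j) := by
    intro N
    calc _ ≤ ∑ j ∈ Finset.range N, eLpNorm (f j) p μ := eLpNorm_sum_le (fun j _ => hf j) hp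
      _ ≤ ∑ j ∈ Finset.range N, ENNReal.ofReal (b j) := Finset.sum_le_sum fun j _ => hfb j
      _ = ENNReal.ofReal (∑ j ∈ Finset.range N, b j) :=
        (ENNReal.ofReal_sum_of_nonneg fun j _ => hb0 j).symm
      _ ≤ _ := ENNReal.ofReal_le_ofReal (hb.sum_le_tsum _ fun j _ => hb0 j)
  refine lt_of_le_of_lt (liminf_le_of_le (by isBoundedDefault) ?_) ENNReal.ofReal_lt_top
    (b := ENNReal.ofReal (∑' j, b j))
  intro c hc
  obtain ⟨N, h⟩ := hc.exists
  exact h.trans (hN N)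

lemma integrable_riesz_mul {n : ℕ} (hn : 1 ≤ n) {α : ℝ} (hα : 0 < α) (hαn : α < n)
    {g : Euc n → ℝ} (hg0 : ∀ y, 0 ≤ g y) (hg : Integrable g) {x : Euc n}
    (hgx : ContinuousAt g x) : Integrable (fun y => ‖x - y‖ ^ (-α) * g y) := by
  have hev : ∀ᶠ y in 𝓝 x, g y < g x + 1 := hgx.eventually_lt_const (by linarith)
  obtain ⟨ρ, hρ, hball⟩ := Metric.eventually_nhds_iff.1 hev
  have hkm : Measurable fun z : Euc n => ‖z‖ ^ (-α) := by fun_prop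
  have hk : IntegrableOn (fun z : Euc n => ‖z‖ ^ (-α)) (ball 0 ρ) :=
    integrableOn_ball_of_norm_le_rpow (C := 1) (by simpa using hn) (by simpa using hαn)
      (Eventually.of_forall fun z => by
        rw [one_mul, Real.norm_of_nonneg (by positivity)]) hkm.aestronglyMeasurable
  have hF : Integrable ((ball (0 : Euc n) ρ).indicator fun z => ‖z‖ ^ (-α) * (g x + 1)) :=
    (integrable_indicator_iff measurableSet_ball).2 (hk.mul_const _)
  refine ((hF.comp_sub_left x).add (hg.const_mul (ρ ^ (-α)))).mono' ?_
    (Eventually.of_forall fun y => ?_)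
  · exact (hkm.comp (measurable_const.sub measurable_id)).aestronglyMeasurable.mul
      hg.aestronglyMeasurable
  · have h0 : 0 ≤ ‖x - y‖ ^ (-α) := by positivity
    have hρ0 : 0 ≤ ρ ^ (-α) := by positivity
    rw [Real.norm_of_nonneg (mul_nonneg h0 (hg0 y))]
    simp only [Pi.add_apply]
    by_cases hy : x - y ∈ ball (0 : Euc n) ρ
    · rw [indicator_of_mem hy]
      have hyx : dist y x < ρ := by
        rw [dist_comm, dist_eq_norm]
        simpa using hy
      have h1 := mul_le_mul_of_nonneg_left (hball hyx).le h0
      have h2 := mul_nonneg hρ0 (hg0 y)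
      linarith
    · rw [indicator_of_notMem hy, zero_add]
      refine mul_le_mul_of_nonneg_right ?_ (hg0 y)
      exact Real.rpow_le_rpow_of_nonpos hρ (by simpa using hy) (by linarith)

lemma riesz_lower_bound {n : ℕ} (hn : 1 ≤ n) {α : ℝ} (hα : 0 < α)
    {g : Euc n → ℝ} (hg0 : ∀ y, 0 ≤ g y) {x a : Euc n} {r M : ℝ} (hr : 0 < r) (hM : 0 ≤ M)
    (hi : Integrable (fun y => ‖x - y‖ ^ (-α) * g y)) (hgM : ∀ y ∈ ball a r, y ≠ 0 → M ≤ g y) :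
    r ^ n * volume.real (ball (0 : Euc n) 1) * ((‖x - a‖ + r) ^ (-α) * M) ≤
      ∫ y, ‖x - y‖ ^ (-α) * g y := by
  have : Nonempty (Fin n) := ⟨⟨0, hn⟩⟩
  have hvol : volume.real (ball a r) = r ^ n * volume.real (ball (0 : Euc n) 1) := by
    have := Measure.addHaar_ball_of_pos (volume : Measure (Euc n)) a hr
    rw [measureReal_def, this, ENNReal.toReal_mul, ENNReal.toReal_ofReal (by positivity)]
    simp [measureReal_def]
  have h1 : ∫ y in ball a r, (‖x - a‖ + r) ^ (-α) * M ≤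
      ∫ y in ball a r, ‖x - y‖ ^ (-α) * g y := by
    refine setIntegral_mono_on_ae (integrableOn_const measure_ball_lt_top.ne) hi.integrableOn
      measurableSet_ball ?_
    have hx : ∀ᵐ y : Euc n, y ≠ x := by simp [ae_iff, measure_singleton]
    have h0 : ∀ᵐ y : Euc n, y ≠ 0 := by simp [ae_iff, measure_singleton]
    filter_upwards [hx, h0] with y hyx hy0 hy
    have hpos : 0 < ‖x - y‖ := norm_pos_iff.2 (sub_ne_zero.2 hyx.symm)
    have hle : ‖x - y‖ ≤ ‖x - a‖ + r := by
      have : ‖a - y‖ < r := by rw [← dist_eq_norm, dist_comm]; exact hy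
      calc ‖x - y‖ = ‖(x - a) + (a - y)‖ := by congr 1; abel
        _ ≤ _ := (norm_add_le _ _).trans (by linarith)
    exact mul_le_mul (Real.rpow_le_rpow_of_nonpos hpos hle (by linarith)) (hgM y hy hy0) hM
      (by positivity)
  rw [setIntegral_const, smul_eq_mul, hvol] at h1
  exact h1.trans (setIntegral_le_integral hi
    (Eventually.of_forall fun y => mul_nonneg (by positivity) (hg0 y)))

lemma le_scaled_bubble {E : Type*} [NormedAddCommGroup E] [InnerProductSpace ℝ E] {r H m : ℝ}
    (hr : 0 < r) (hH : 0 ≤ H) (hm : 0 ≤ m) {y : E} (hy : ‖y‖ ≤ r) :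
    H * 2 ^ (-m) ≤ H * r ^ (2 * m) * bubble (r ^ 2) m y := by
  rw [scaled_bubble_eq hr]
  refine mul_le_mul_of_nonneg_left ?_ hH
  refine Real.rpow_le_rpow_of_nonpos (by positivity) ?_ (by linarith)
  have h1 : ‖r⁻¹ • y‖ ≤ 1 := by
    rw [norm_smul, norm_inv, Real.norm_of_nonneg hr.le, inv_mul_le_iff₀ hr]
    linarith
  nlinarith [norm_nonneg (r⁻¹ • y)]

lemma laplacian_scaled_bubble_le {n : ℕ} (hn : 3 ≤ n) {α lam r H κ ρ : ℝ} (hα : 0 < α)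
    (hαn : α < n) (hr : 0 < r) (hH : 0 < H) (hρ : 0 ≤ ρ) (hκ : 0 < κ)
    (h : (n : ℝ) * (n - 2) / (κ * 2 ^ (-(α / 2))) ≤ H ^ (lam - 1) * r ^ ((n : ℝ) + 2 - α)) :
    H * r ^ (2 * (((n : ℝ) - 2) / 2)) *
        (n * (n - 2) * r ^ 2 * (r ^ 2 + ρ ^ 2) ^ (-((n : ℝ) + 2) / 2)) ≤
      κ * (r ^ n * ((ρ + r) ^ (-α) * H ^ lam)) := by
  have hn' : (3 : ℝ) ≤ n := by exact_mod_cast hn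
  set Q := r ^ 2 + ρ ^ 2 with hQ
  have hQ0 : 0 < Q := by positivity
  have e1 : r ^ (2 * (((n : ℝ) - 2) / 2)) * r ^ 2 = r ^ n := by
    rw [← Real.rpow_natCast r 2, ← Real.rpow_add hr, ← Real.rpow_natCast r n]
    congr 1
    push_cast
    ring
  have e2 : Q ^ (-((n : ℝ) + 2) / 2) ≤ Q ^ (-(α / 2)) * (r ^ ((n : ℝ) + 2 - α))⁻¹ := by
    have : Q ^ (-((n : ℝ) + 2) / 2) = Q ^ (-(α / 2)) * Q ^ (-(((n : ℝ) + 2 - α) / 2)) := by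
      rw [← Real.rpow_add hQ0]
      congr 1
      ring
    rw [this]
    refine mul_le_mul_of_nonneg_left ?_ (by positivity)
    have h2 : (r ^ ((n : ℝ) + 2 - α))⁻¹ = (r ^ 2) ^ (-(((n : ℝ) + 2 - α) / 2)) := by
      rw [← Real.rpow_natCast_mul hr.le, ← Real.rpow_neg hr.le]
      congr 1
      push_cast
      ring
    rw [h2]
    exact Real.rpow_le_rpow_of_nonpos (by positivity) (by rw [hQ]; nlinarith) (by linarith)
  have e3 : 2 ^ (-(α / 2)) * Q ^ (-(α / 2)) ≤ (ρ + r) ^ (-α) := by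
    have h2 : (ρ + r) ^ (-α) = ((ρ + r) ^ 2) ^ (-(α / 2)) := by
      rw [← Real.rpow_natCast_mul (by positivity)]
      congr 1
      push_cast
      ring
    rw [h2, ← Real.mul_rpow (by norm_num) hQ0.le]
    refine Real.rpow_le_rpow_of_nonpos (by positivity) ?_ (by linarith)
    rw [hQ]
    nlinarith [sq_nonneg (ρ - r)]
  have e4 : H ^ lam = H * H ^ (lam - 1) := by
    rw [mul_comm, ← Real.rpow_add_one hH.ne']
    congr 1
    ring
  have hR : 0 < r ^ ((n : ℝ) + 2 - α) := by positivity
  rw [div_le_iff₀ (by positivity)] at h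
  calc _ = (n * (n - 2)) * (H * r ^ n * Q ^ (-((n : ℝ) + 2) / 2)) := by rw [← e1]; ring
    _ ≤ (n * (n - 2)) * (H * r ^ n * (Q ^ (-(α / 2)) * (r ^ ((n : ℝ) + 2 - α))⁻¹)) := by
      have : (0 : ℝ) ≤ n * (n - 2) := mul_nonneg (by linarith) (by linarith)
      gcongr
    _ ≤ (H ^ (lam - 1) * r ^ ((n : ℝ) + 2 - α) * (κ * 2 ^ (-(α / 2)))) *
        (H * r ^ n * (Q ^ (-(α / 2)) * (r ^ ((n : ℝ) + 2 - α))⁻¹)) := by gcongr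
    _ = κ * (r ^ n * ((2 ^ (-(α / 2)) * Q ^ (-(α / 2))) * H ^ lam)) := by
      rw [e4]
      field_simp
    _ ≤ _ := by gcongr

theorem stmt4 (n : ℕ) (hn : 3 ≤ n) (α lam sig : ℝ)
    (hα2 : 2 < α) (hαn : α < n)
    (hlam : (n : ℝ) / (α - 2) < lam)
    (hsig : sig = 0)
    (φ : ℝ → ℝ) (hφc : ContinuousOn φ (Ioo 0 1))
    (hφp : ∀ t ∈ Ioo (0:ℝ) 1, 0 < φ t)
    (hφl : Tendsto φ (𝓝[>] (0:ℝ)) atTop) :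
    ∃ u : Euc n → ℝ, IsCPSolution n α lam sig u ∧ NotBigOAt n u φ := by
  subst hsig
  have hn' : (3 : ℝ) ≤ n := by exact_mod_cast hn
  set m : ℝ := ((n : ℝ) - 2) / 2 with hm_def
  have h2m : 2 * m = n - 2 := by rw [hm_def]; ring
  have hm : 0 < m := by linarith
  have hlam' : (n : ℝ) < lam * (α - 2) := (div_lt_iff₀ (by linarith)).1 hlam
  have hlam1 : 1 < lam := by nlinarith
  have hlam0 : 0 < lam := by linarith
  have hnlam : (n : ℝ) < 2 * m * lam := by rw [h2m]; nlinarith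
  have hexp : (n : ℝ) / lam ≤ 2 * m := ((div_lt_iff₀ hlam0).2 hnlam).le
  obtain ⟨I, hI0, hI⟩ := eLpNorm_scaled_bubble_le hlam0 hnlam
  set V : ℝ := volume.real (ball (0 : Euc n) 1) with hV
  have hV0 : 0 < V := ENNReal.toReal_pos (measure_ball_pos volume _ one_pos).ne'
    measure_ball_lt_top.ne
  set κ : ℕ → ℝ := fun j => 1 / 2 / 2 ^ j * (V * 2 ^ (-m * lam)) with hκ
  have hκ0 : ∀ j, 0 < κ j := fun j => by simp only [hκ]; positivity
  set a : ℕ → Euc n := fun j => EuclideanSpace.single ⟨0, by omega⟩ ((1 / 2 : ℝ) ^ (j + 1)) with ha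
  have hanorm : ∀ j, ‖a j‖ = (1 / 2 : ℝ) ^ (j + 1) := fun j => by
    simp [ha]
  have ha0 : ∀ j, a j ≠ 0 := fun j => by
    rw [← norm_pos_iff, hanorm]; positivity
  have hat : Tendsto a atTop (𝓝 0) := by
    rw [tendsto_zero_iff_norm_tendsto_zero]
    simp_rw [hanorm]
    exact (tendsto_pow_atTop_nhds_zero_of_lt_one (by norm_num) (by norm_num)).comp
      (tendsto_add_atTop_nat 1)
  have hφa : ∀ j, 0 < φ ‖a j‖ := fun j => by
    refine hφp _ ⟨norm_pos_iff.2 (ha0 j), ?_⟩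
    rw [hanorm]
    exact pow_lt_one₀ (by norm_num) (by norm_num) (by omega)
  choose r H hr hr1 hH hHr hHφ hHl using fun j : ℕ => exists_scale hαn hα2 hlam
    ((n : ℝ) * (n - 2) / (κ j * 2 ^ (-(α / 2)))) (j * φ ‖a j‖)
    (ε := (1 / 2) ^ j) (by positivity)
  set v : ℕ → Euc n → ℝ := fun j x => H j * r j ^ (2 * m) * bubble (r j ^ 2) m (x - a j) with hv
  have hv0 : ∀ j x, 0 ≤ v j x := fun j x => by
    have := hH j
    have := hr j
    simp only [hv, bubble]
    positivity
  set u : Euc n → ℝ := fun x => ∑' j, v j x with hu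
  have hgeo : Summable fun j : ℕ => (1 / 2 : ℝ) ^ j := summable_geometric_two
  have hcs : Summable fun j => H j * r j ^ (2 * m) := by
    refine Summable.of_nonneg_of_le (fun j => ?_) (fun j => ?_) hgeo
    · exact mul_nonneg (hH j).le (Real.rpow_nonneg (hr j).le _)
    · exact (mul_le_mul_of_nonneg_left
        (Real.rpow_le_rpow_of_exponent_ge (hr j) (hr1 j) hexp) (hH j).le).trans (hHr j)
  obtain ⟨hC2, hser⟩ := bubble_series hn (a := a) (c := fun j => H j * r j ^ (2 * m))
    (s := fun j => r j ^ 2) (fun j => mul_pos (hH j) (Real.rpow_pos_of_pos (hr j) _))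
    (fun j => pow_pos (hr j) 2) hcs hat (u := u) rfl
  have hu0 : ∀ x, 0 ≤ u x := fun x => tsum_nonneg fun j => hv0 j x
  have hvu : ∀ j, ∀ x ≠ 0, v j x ≤ u x := fun j x hx =>
    (hser x hx).1.le_tsum j fun i _ => hv0 i x
  have hmem : MemLp u (ENNReal.ofReal lam) volume := by
    refine memLp_tsum (by simpa using hlam1.le) (fun j => ?_) (hgeo.mul_right I)
      (fun j => by positivity) (fun j => (hI _ _ (a j) (hr j) (hH j)).trans
        (ENNReal.ofReal_le_ofReal (mul_le_mul_of_nonneg_right (hHr j) hI0))) ?_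
    · refine Continuous.aestronglyMeasurable ?_
      have := hr j
      exact continuous_const.mul (Continuous.rpow_const (by fun_prop) fun y =>
        Or.inl (by positivity))
    · have h0 : ∀ᵐ y : Euc n, y ≠ 0 := by
        have : Nonempty (Fin n) := ⟨⟨0, by omega⟩⟩
        simp [ae_iff, measure_singleton]
      exact h0.mono fun x hx => (hser x hx).1
  have hint : Integrable fun y => u y ^ lam := by
    have := hmem.integrable_norm_rpow (by simpa using hlam0) ENNReal.ofReal_ne_top
    simpa [ENNReal.toReal_ofReal hlam0.le, abs_of_nonneg (hu0 _)] using this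
  refine ⟨u, ⟨hu0, hC2, hint, fun x hx => ?_⟩, a, ha0, hat, ?_⟩
  · have hx0 : x ≠ 0 := hx.2
    have hlap := (hser x hx0).2
    have hucont : ContinuousAt (fun y => u y ^ lam) x :=
      (hC2.continuousOn.continuousAt (isOpen_compl_singleton.mem_nhds hx0)).rpow_const
        (Or.inr hlam0.le)
    have hri := integrable_riesz_mul (by omega) (by linarith) hαn
      (fun y => Real.rpow_nonneg (hu0 y) lam) hint hucont
    rw [Real.rpow_zero, mul_one]
    constructor
    · refine hlap.nonneg fun j => ?_
      have := hH j
      have := hr j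
      have : (0 : ℝ) ≤ n - 2 := by linarith
      positivity
    · have hgeo' := (hasSum_geometric_two' (1 : ℝ)).mul_right
        (∫ y, ‖x - y‖ ^ (-α) * u y ^ lam)
      rw [one_mul] at hgeo'
      refine hasSum_le (fun j => ?_) hlap hgeo'
      have hlow := riesz_lower_bound (by omega) (by linarith)
        (fun y => Real.rpow_nonneg (hu0 y) lam) (x := x) (a := a j) (r := r j)
        (M := (H j * 2 ^ (-m)) ^ lam) (hr j)
        (Real.rpow_nonneg (mul_nonneg (hH j).le (by positivity)) _) hri
        (fun y hy hy0 => by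
          refine Real.rpow_le_rpow (mul_nonneg (hH j).le (by positivity))
            ((le_scaled_bubble (hr j) (hH j).le hm.le ?_).trans (hvu j y hy0)) hlam0.le
          rw [← dist_eq_norm]
          exact (mem_ball.1 hy).le)
      refine (laplacian_scaled_bubble_le hn (by linarith) hαn (hr j) (hH j) (norm_nonneg (x - a j))
        (hκ0 j) (hHl j)).trans (le_trans (le_of_eq ?_)
          (mul_le_mul_of_nonneg_left hlow (by positivity)))
      rw [Real.mul_rpow (hH j).le (by positivity), ← Real.rpow_mul (by norm_num)]
      simp only [hκ]
      ring
  · refine tendsto_atTop_mono (fun j => ?_) tendsto_natCast_atTop_atTop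
    rw [le_div_iff₀ (hφa j)]
    refine (hHφ j).trans (le_trans (le_of_eq ?_) (hvu j (a j) (ha0 j)))
    simp only [hv]
    rw [scaled_bubble_eq (hr j)]
    simp
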